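/- Let A be a closed symmetric operator in a complex Hilbert space H that is bounded from below, i.e., there exists c ∈ ℝ with (f, Af) ≥ c‖f‖² for all f ∈ dom(A). Then dim ker(A* − z I) is constant as z ranges over ℂ \ [c, ∞). -/

import Mathlib

open scoped InnerProductSpace LinearPMap

namespace DefConst

open scoped ComplexConjugate Topology

variable {H : Type*} [NormedAddCommGroup H] [InnerProductSpace ℂ H]

/-- The range of `A - conj z`. -/
noncomputable def R (A : H →ₗ.[ℂ] H) (z : ℂ) : Submodule ℂ H :=
  LinearMap.range (A.toFun - conj z • A.domain.subtype)

/-- The half line `[c, ∞)` in the complex plane. -/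
def K (c : ℝ) : Set ℂ := {z | z.im = 0 ∧ c ≤ z.re}

lemma mem_R (A : H →ₗ.[ℂ] H) (z : ℂ) (v : H) :
    v ∈ R A z ↔ ∃ f : A.domain, A f - conj z • (f : H) = v := Iff.rfl

lemma lower (A : H →ₗ.[ℂ] H)
    (hsym : ∀ f g : A.domain, ⟪A f, (g : H)⟫_ℂ = ⟪(f : H), A g⟫_ℂ)
    (c : ℝ) (hbound : ∀ f : A.domain, c * ‖(f : H)‖ ^ 2 ≤ (⟪(f : H), A f⟫_ℂ).re)
    (z : ℂ) (f : A.domain) :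
    Metric.infDist z (K c) * ‖(f : H)‖ ≤ ‖A f - conj z • (f : H)‖ := by
  by_cases hf : ‖(f : H)‖ = 0
  · simp [hf]
  have hpos : 0 < ‖(f : H)‖ := lt_of_le_of_ne (norm_nonneg _) (Ne.symm hf)
  set t : ℝ := (⟪(f : H), A f⟫_ℂ).re / ‖(f : H)‖ ^ 2 with ht
  have htK : (t : ℂ) ∈ K c := by
    refine ⟨Complex.ofReal_im t, ?_⟩
    rw [Complex.ofReal_re, ht, le_div_iff₀ (by positivity)]
    exact hbound f
  have him : (⟪(f : H), A f⟫_ℂ) = ((⟪(f : H), A f⟫_ℂ).re : ℂ) := by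
    have h1 : conj (⟪(f : H), A f⟫_ℂ) = ⟪(f : H), A f⟫_ℂ := by
      rw [inner_conj_symm, hsym]
    exact (Complex.conj_eq_iff_re.1 h1).symm
  have hre : (⟪(f : H), A f⟫_ℂ) = (t : ℂ) * (‖(f : H)‖ : ℂ) ^ 2 := by
    rw [him, ht]
    have hfc : (‖(f : H)‖ : ℂ) ≠ 0 := Complex.ofReal_ne_zero.2 hf
    push_cast
    rw [div_mul_cancel₀ _ (pow_ne_zero 2 hfc)]
  have h2 : ⟪(f : H), A f - conj z • (f : H)⟫_ℂ = conj ((t : ℂ) - z) * (‖(f : H)‖ : ℂ) ^ 2 := by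
    rw [inner_sub_right, inner_smul_right, inner_self_eq_norm_sq_to_K, hre, map_sub,
      Complex.conj_ofReal]
    simp only [Complex.coe_algebraMap]
    ring
  have h3 : ‖(t : ℂ) - z‖ * ‖(f : H)‖ ^ 2 ≤ ‖(f : H)‖ * ‖A f - conj z • (f : H)‖ := by
    have := norm_inner_le_norm (𝕜 := ℂ) (f : H) (A f - conj z • (f : H))
    rw [h2, norm_mul, RCLike.norm_conj, norm_pow, Complex.norm_real, norm_norm] at this
    exact this
  have h4 : Metric.infDist z (K c) ≤ ‖(t : ℂ) - z‖ := by
    have := Metric.infDist_le_dist_of_mem (x := z) htK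
    rwa [dist_comm, dist_eq_norm] at this
  have h5 : ‖(t : ℂ) - z‖ * ‖(f : H)‖ ≤ ‖A f - conj z • (f : H)‖ := by
    refine le_of_mul_le_mul_left ?_ hpos
    nlinarith [h3]
  exact (mul_le_mul_of_nonneg_right h4 hpos.le).trans h5

lemma rank_le [CompleteSpace H] (A : H →ₗ.[ℂ] H) (z w : ℂ) (d : ℝ)
    (hd : ∀ f : A.domain, d * ‖(f : H)‖ ≤ ‖A f - conj z • (f : H)‖) (hzw : ‖z - w‖ < d) :
    Module.rank ℂ ↥((R A w)ᗮ) ≤ Module.rank ℂ ↥((R A z)ᗮ) := by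
  have hd0 : 0 < d := (norm_nonneg _).trans_lt hzw
  let φ : ↥((R A w)ᗮ) →ₗ[ℂ] ↥((R A z)ᗮ) :=
    ((R A z)ᗮ.orthogonalProjectionOnto : H →ₗ[ℂ] ↥((R A z)ᗮ)).comp (R A w)ᗮ.subtype
  refine LinearMap.rank_le_of_injective φ ?_
  rw [← LinearMap.ker_eq_bot, LinearMap.ker_eq_bot']
  rintro ⟨u, hu⟩ h
  have hu2 : u ∈ (R A z)ᗮᗮ := Submodule.orthogonalProjectionOnto_eq_zero_iff.1 h
  rw [Submodule.orthogonal_orthogonal_eq_closure] at hu2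
  have key : ∀ v ∈ R A z, d * ‖⟪u, v⟫_ℂ‖ ≤ ‖z - w‖ * ‖u‖ * ‖v‖ := by
    rintro v hv
    obtain ⟨f, rfl⟩ := (mem_R A z v).1 hv
    have h0 : ⟪u, A f - conj w • (f : H)⟫_ℂ = 0 :=
      (Submodule.mem_orthogonal' _ _).1 hu _ ((mem_R A w _).2 ⟨f, rfl⟩)
    have h1 : ⟪u, A f - conj z • (f : H)⟫_ℂ = - (conj (z - w) * ⟪u, (f : H)⟫_ℂ) := by
      rw [inner_sub_right, inner_smul_right] at h0 ⊢
      rw [map_sub]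
      linear_combination h0
    rw [h1, norm_neg, norm_mul, RCLike.norm_conj]
    have h2 := norm_inner_le_norm (𝕜 := ℂ) u (f : H)
    calc d * (‖z - w‖ * ‖⟪u, (f : H)⟫_ℂ‖) ≤ d * (‖z - w‖ * (‖u‖ * ‖(f : H)‖)) := by gcongr
      _ = ‖z - w‖ * ‖u‖ * (d * ‖(f : H)‖) := by ring
      _ ≤ _ := by gcongr; exact hd f
  have key2 : d * ‖⟪u, u⟫_ℂ‖ ≤ ‖z - w‖ * ‖u‖ * ‖u‖ := by
    have hcl : IsClosed {v : H | d * ‖⟪u, v⟫_ℂ‖ ≤ ‖z - w‖ * ‖u‖ * ‖v‖} :=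
      isClosed_le (by fun_prop) (by fun_prop)
    exact closure_minimal (fun v hv => key v hv) hcl hu2
  rw [inner_self_eq_norm_sq_to_K, norm_pow, RCLike.norm_ofReal,
    abs_norm] at key2
  have : ‖u‖ = 0 := by
    by_contra hne
    have hp : 0 < ‖u‖ := lt_of_le_of_ne (norm_nonneg _) (Ne.symm hne)
    nlinarith [mul_pos hp hp]
  exact Subtype.ext (norm_eq_zero.1 this)

lemma rank_ker [CompleteSpace H] (A : H →ₗ.[ℂ] H) (hdense : Dense (A.domain : Set H)) (z : ℂ) :
    Module.rank ℂ ↥(LinearMap.ker ((A†).toFun - z • (A†).domain.subtype)) =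
      Module.rank ℂ ↥((R A z)ᗮ) := by
  have e : (LinearMap.ker ((A†).toFun - z • (A†).domain.subtype)).map (A†).domain.subtype
      = (R A z)ᗮ := by
    ext u
    rw [Submodule.mem_map, Submodule.mem_orthogonal']
    constructor
    · rintro ⟨y, hy, rfl⟩ v hv
      obtain ⟨f, rfl⟩ := (mem_R A z v).1 hv
      have hy' : A† y = z • (y : H) := sub_eq_zero.1 (LinearMap.mem_ker.1 hy)
      have := LinearPMap.adjoint_isFormalAdjoint hdense y f
      rw [hy', inner_smul_left] at this
      rw [inner_sub_right, inner_smul_right]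
      exact sub_eq_zero.2 this.symm
    · intro h
      have h' : ∀ x : A.domain, ⟪z • u, (x : H)⟫_ℂ = ⟪u, A x⟫_ℂ := by
        intro x
        have := h _ ((mem_R A z _).2 ⟨x, rfl⟩)
        rw [inner_sub_right, inner_smul_right] at this
        rw [inner_smul_left]
        exact (sub_eq_zero.1 this).symm
      have hu := LinearPMap.mem_adjoint_domain_of_exists (T := A) u ⟨z • u, h'⟩
      refine ⟨⟨u, hu⟩, ?_, rfl⟩
      rw [LinearMap.mem_ker]
      exact sub_eq_zero.2 (LinearPMap.adjoint_apply_eq hdense ⟨u, hu⟩ h')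
  rw [← e]
  exact (Submodule.equivMapOfInjective _ (Submodule.injective_subtype _) _).rank_eq

lemma preconn (c : ℝ) : IsPreconnected (K c)ᶜ := by
  have h : (K c)ᶜ = (fun z : ℂ => (c : ℂ) - z) '' Complex.slitPlane := by
    ext z
    constructor
    · intro hz
      refine ⟨c - z, ?_, by simp⟩
      by_contra h
      rw [Complex.mem_slitPlane_iff] at h
      push Not at h
      simp at h
      exact hz ⟨h.2, h.1⟩
    · rintro ⟨w, hw, rfl⟩ ⟨h1, h2⟩
      rw [Complex.mem_slitPlane_iff] at hw
      simp at h1 h2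
      rcases hw with hw | hw
      · linarith
      · exact hw h1
  rw [h]
  exact (Complex.starConvex_one_slitPlane.isPathConnected
    Complex.one_mem_slitPlane).isConnected.isPreconnected.image _ (by fun_prop)

lemma closedK (c : ℝ) : IsClosed (K c) :=
  (isClosed_eq Complex.continuous_im continuous_const).inter
    (isClosed_le continuous_const Complex.continuous_re)

end DefConst

/-- For a closed symmetric operator `A` bounded from below by `c`, the dimension of
`ker(A* − zI)` is constant for `z ∈ ℂ \ [c, ∞)`. -/
theorem deficiency_constant_of_bounded_below
    {H : Type*} [NormedAddCommGroup H] [InnerProductSpace ℂ H] [CompleteSpace H]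
    (A : H →ₗ.[ℂ] H) (hdense : Dense (A.domain : Set H)) (hclosed : A.IsClosed)
    (hsym : ∀ f g : A.domain, ⟪A f, (g : H)⟫_ℂ = ⟪(f : H), A g⟫_ℂ)
    (c : ℝ) (hbound : ∀ f : A.domain, c * ‖(f : H)‖ ^ 2 ≤ (⟪(f : H), A f⟫_ℂ).re) :
    ∀ z w : ℂ, ¬(z.im = 0 ∧ c ≤ z.re) → ¬(w.im = 0 ∧ c ≤ w.re) →
      Module.rank ℂ ↥(LinearMap.ker ((A†).toFun - z • (A†).domain.subtype)) =
        Module.rank ℂ ↥(LinearMap.ker ((A†).toFun - w • (A†).domain.subtype)) := by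
  intro z w hz hw
  rw [DefConst.rank_ker A hdense, DefConst.rank_ker A hdense]
  refine (DefConst.preconn c).induction₂'
    (fun z w => Module.rank ℂ ↥((DefConst.R A z)ᗮ) = Module.rank ℂ ↥((DefConst.R A w)ᗮ))
    ?_ (fun _ _ _ _ _ _ h1 h2 => h1.trans h2) hz hw
  intro x hx
  have hne : (DefConst.K c).Nonempty := ⟨(c : ℂ), by simp [DefConst.K]⟩
  have hpos : 0 < Metric.infDist x (DefConst.K c) :=
    ((DefConst.closedK c).notMem_iff_infDist_pos hne).1 hx
  refine nhdsWithin_le_nhds ?_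
  filter_upwards [Metric.ball_mem_nhds x (half_pos hpos)] with y hy
  rw [Metric.mem_ball] at hy
  have h1 : Metric.infDist x (DefConst.K c) ≤ Metric.infDist y (DefConst.K c) + dist x y :=
    Metric.infDist_le_infDist_add_dist
  have h2 := DefConst.rank_le A x y _ (DefConst.lower A hsym c hbound x)
    (by rw [← dist_eq_norm, dist_comm]; linarith)
  have h3 := DefConst.rank_le A y x _ (DefConst.lower A hsym c hbound y)
    (by rw [← dist_eq_norm]; rw [dist_comm] at h1; linarith)
  exact ⟨le_antisymm h3 h2, le_antisymm h2 h3⟩
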